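/- Let μ ≠ 0 be a nilpotent Lie bracket on ℝ^{2n} for which the 2-form ω is closed. Then the following are equivalent: (a) for every g ∈ Sp(n,ℝ), tr(Ricac_{g·μ}²)/‖g·μ‖⁴ ≥ tr(Ricac_μ²)/‖μ‖⁴; (b) Ricac_μ = cI + D for some c ∈ ℝ and some derivation D ∈ Der(μ). -/

import Mathlib

open scoped BigOperators Matrix

abbrev Vm (m : ℕ) := (Fin m → ℝ) → (Fin m → ℝ) → (Fin m → ℝ)

def IsSkewBilin {m : ℕ} (μ : Vm m) : Prop :=
  (∀ (c : ℝ) (X X' Y : Fin m → ℝ), μ (c • X + X') Y = c • μ X Y + μ X' Y) ∧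
  (∀ (c : ℝ) (X Y Y' : Fin m → ℝ), μ X (c • Y + Y') = c • μ X Y + μ X Y') ∧
  (∀ X Y, μ X Y = - μ Y X)

/-- The Jacobi identity. -/
def Jacobi {m : ℕ} (μ : Vm m) : Prop :=
  ∀ X Y Z, μ (μ X Y) Z + μ (μ Y Z) X + μ (μ Z X) Y = 0

/-- Left-normed iterated bracket `μ(X_k, μ(X_{k-1}, ⋯ μ(X_1, X_0)⋯))`. -/
def iterBrk {m : ℕ} (μ : Vm m) (X : ℕ → (Fin m → ℝ)) : ℕ → (Fin m → ℝ)
  | 0 => X 0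
  | (k+1) => μ (X (k+1)) (iterBrk μ X k)

/-- `(ℝᵐ, μ)` is a nilpotent Lie algebra: some term of the lower central series vanishes,
equivalently all left-normed brackets of some fixed length vanish. -/
def IsNilp {m : ℕ} (μ : Vm m) : Prop :=
  ∃ k : ℕ, ∀ X : ℕ → (Fin m → ℝ), iterBrk μ X k = 0

noncomputable def stdb (m : ℕ) (i : Fin m) : Fin m → ℝ := Pi.single i 1

noncomputable def Ric {m : ℕ} (μ : Vm m) : Matrix (Fin m) (Fin m) ℝ :=
  Matrix.of fun x y =>
    -(1/2) * (∑ i, ∑ j, μ (stdb m x) (stdb m i) j * μ (stdb m y) (stdb m i) j)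
      + (1/4) * (∑ i, ∑ j, μ (stdb m i) (stdb m j) x * μ (stdb m i) (stdb m j) y)

noncomputable def normSq {m : ℕ} (μ : Vm m) : ℝ :=
  ∑ i, ∑ j, ∑ k, (μ (stdb m i) (stdb m j) k) ^ 2

/-- `D` is a derivation of the bracket `μ`. -/
def IsDeriv {m : ℕ} (μ : Vm m) (D : Matrix (Fin m) (Fin m) ℝ) : Prop :=
  ∀ X Y, D.mulVec (μ X Y) = μ (D.mulVec X) Y + μ X (D.mulVec Y)

/-- The action `(g·μ)(X,Y) = g μ(g⁻¹X, g⁻¹Y)` of `GL(n,ℝ)` on brackets. -/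
noncomputable def act {m : ℕ} (g : GL (Fin m) ℝ) (μ : Vm m) : Vm m :=
  fun X Y =>
    (g : Matrix (Fin m) (Fin m) ℝ).mulVec
      (μ (((g⁻¹ : GL (Fin m) ℝ) : Matrix (Fin m) (Fin m) ℝ).mulVec X)
         (((g⁻¹ : GL (Fin m) ℝ) : Matrix (Fin m) (Fin m) ℝ).mulVec Y))


/-- The standard (almost-)complex structure `J` on `ℝ^{2n}`:
`J e_i = e_{2n+1-i}` for `i ≤ n` and `J e_i = -e_{2n+1-i}` for `i > n` (1-indexed). -/
noncomputable def Jst (n : ℕ) : Matrix (Fin (2*n)) (Fin (2*n)) ℝ :=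
  Matrix.of fun x y =>
    if (x : ℕ) + (y : ℕ) = 2*n - 1 then (if (y : ℕ) < n then 1 else -1) else 0

/-- The symplectic form `ω(X,Y) = ⟨X, JY⟩` on `ℝ^{2n}`. -/
noncomputable def omegaSt (n : ℕ) (X Y : Fin (2*n) → ℝ) : ℝ :=
  ∑ i, X i * (Jst n).mulVec Y i

/-- `ω` is closed for the bracket `μ`. -/
def OmegaClosed (n : ℕ) (μ : Vm (2*n)) : Prop :=
  ∀ X Y Z, omegaSt n (μ X Y) Z + omegaSt n (μ Y Z) X + omegaSt n (μ Z X) Y = 0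

/-- Membership in `Sp(n,ℝ)`: `g` preserves `ω`. -/
def InSp (n : ℕ) (g : GL (Fin (2*n)) ℝ) : Prop :=
  ∀ X Y, omegaSt n ((g : Matrix (Fin (2*n)) (Fin (2*n)) ℝ).mulVec X)
      ((g : Matrix (Fin (2*n)) (Fin (2*n)) ℝ).mulVec Y) = omegaSt n X Y

/-- The anti-complexified Ricci operator `Ricac_μ = (1/2)(Ric_μ + J Ric_μ J)`. -/
noncomputable def Ricac (n : ℕ) (μ : Vm (2*n)) : Matrix (Fin (2*n)) (Fin (2*n)) ℝ :=
  (1/2 : ℝ) • (Ric μ + Jst n * Ric μ * Jst n)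

/-- Infinitesimal action of a matrix on brackets. -/
def infAct {m : ℕ} (A : Matrix (Fin m) (Fin m) ℝ) (μ : Vm m) : Vm m :=
  fun X Y => A.mulVec (μ X Y) - μ (A.mulVec X) Y - μ X (A.mulVec Y)

/-- Inner product of brackets inducing `normSq`. -/
noncomputable def brkInner {m : ℕ} (μ ν : Vm m) : ℝ :=
  ∑ i, ∑ j, ∑ k, μ (stdb m i) (stdb m j) k * ν (stdb m i) (stdb m j) k

/-- The (non-symmetrized) polarization of `Ric`. -/
noncomputable def ricPolar {m : ℕ} (μ ν : Vm m) : Matrix (Fin m) (Fin m) ℝ :=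
  Matrix.of fun x y =>
    -(1/2) * (∑ i, ∑ j, μ (stdb m x) (stdb m i) j * ν (stdb m y) (stdb m i) j)
      + (1/4) * (∑ i, ∑ j, μ (stdb m i) (stdb m j) x * ν (stdb m i) (stdb m j) y)

lemma ricPolar_self {m : ℕ} (μ : Vm m) : ricPolar μ μ = Ric μ := rfl

lemma Ric_transpose {m : ℕ} (μ : Vm m) : (Ric μ)ᵀ = Ric μ := by
  ext x y
  simp only [Ric, Matrix.transpose_apply, Matrix.of_apply, mul_comm]

lemma normSq_eq_brkInner {m : ℕ} (μ : Vm m) : normSq μ = brkInner μ μ := by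
  simp only [normSq, brkInner, pow_two]

lemma normSq_nonneg {m : ℕ} (μ : Vm m) : 0 ≤ normSq μ := by
  unfold normSq; positivity

lemma sum_smul_stdb {m : ℕ} (X : Fin m → ℝ) : ∑ a, X a • stdb m a = X := by
  ext i
  simp [stdb, Pi.single_apply]

lemma sum_rotate₃ {m : ℕ} (F : Fin m → Fin m → Fin m → ℝ) :
    ∑ k, ∑ i, ∑ j, F k i j = ∑ i, ∑ j, ∑ k, F k i j := by
  rw [Finset.sum_comm]
  exact Finset.sum_congr rfl fun i _ => Finset.sum_comm

lemma sum_comm₄ {m : ℕ} (F : Fin m → Fin m → Fin m → Fin m → ℝ) :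
    ∑ i, ∑ j, ∑ k, ∑ l, F i j k l = ∑ l, ∑ k, ∑ i, ∑ j, F i j k l := by
  calc ∑ i, ∑ j, ∑ k, ∑ l, F i j k l
      = ∑ i, ∑ l, ∑ k, ∑ j, F i j k l := by
        refine Finset.sum_congr rfl fun i _ => ?_
        rw [sum_rotate₃, Finset.sum_comm]
    _ = ∑ l, ∑ k, ∑ i, ∑ j, F i j k l := by rw [sum_rotate₃]

namespace IsSkewBilin

variable {m : ℕ} {μ : Vm m}

/-- A skew-symmetric bilinear bracket as a bilinear map. -/
def toLin (h : IsSkewBilin μ) : (Fin m → ℝ) →ₗ[ℝ] (Fin m → ℝ) →ₗ[ℝ] (Fin m → ℝ) :=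
  have zl : ∀ Y, μ 0 Y = 0 := fun Y => by simpa using h.1 1 0 0 Y
  have zr : ∀ X, μ X 0 = 0 := fun X => by simpa using h.2.1 1 X 0 0
  LinearMap.mk₂ ℝ μ
    (fun X X' Y => by simpa using h.1 1 X X' Y)
    (fun c X Y => by simpa [zl] using h.1 c X 0 Y)
    (fun X Y Y' => by simpa using h.2.1 1 X Y Y')
    (fun c X Y => by simpa [zr] using h.2.1 c X Y 0)

lemma toLin_apply (h : IsSkewBilin μ) (X Y : Fin m → ℝ) : h.toLin X Y = μ X Y := rfl

lemma expand (h : IsSkewBilin μ) (X Y : Fin m → ℝ) :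
    μ X Y = ∑ a, ∑ b, (X a * Y b) • μ (stdb m a) (stdb m b) := by
  conv_lhs => rw [← h.toLin_apply, ← sum_smul_stdb X, ← sum_smul_stdb Y]
  simp only [map_sum, map_smul, LinearMap.sum_apply, LinearMap.smul_apply, toLin_apply,
    Finset.smul_sum, smul_smul]
  rw [Finset.sum_comm]
  exact Finset.sum_congr rfl fun a _ => Finset.sum_congr rfl fun b _ => by rw [mul_comm]

lemma ext_stdb {ν : Vm m} (h : IsSkewBilin μ) (h' : IsSkewBilin ν)
    (e : ∀ i j k, μ (stdb m i) (stdb m j) k = ν (stdb m i) (stdb m j) k) : μ = ν := by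
  funext X Y
  rw [h.expand, h'.expand]
  refine Finset.sum_congr rfl fun a _ => Finset.sum_congr rfl fun b _ => ?_
  congr 1
  funext k
  exact e a b k

lemma act (h : IsSkewBilin μ) (g : GL (Fin m) ℝ) : IsSkewBilin (act g μ) := by
  refine ⟨fun c X X' Y => ?_, fun c X Y Y' => ?_, fun X Y => ?_⟩
  · simp only [_root_.act, Matrix.mulVec_add, Matrix.mulVec_smul, h.1]
  · simp only [_root_.act, Matrix.mulVec_add, Matrix.mulVec_smul, h.2.1]
  · simp only [_root_.act]
    rw [h.2.2, Matrix.mulVec_neg]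

lemma infAct (h : IsSkewBilin μ) (A : Matrix (Fin m) (Fin m) ℝ) :
    IsSkewBilin (infAct A μ) := by
  refine ⟨fun c X X' Y => ?_, fun c X Y Y' => ?_, fun X Y => ?_⟩
  · simp only [_root_.infAct, Matrix.mulVec_add, Matrix.mulVec_smul, h.1]
    module
  · simp only [_root_.infAct, Matrix.mulVec_add, Matrix.mulVec_smul, h.2.1]
    module
  · simp only [_root_.infAct]
    rw [h.2.2 X Y, h.2.2 _ Y, h.2.2 X, Matrix.mulVec_neg]
    abel

lemma smul (h : IsSkewBilin μ) (c : ℝ) : IsSkewBilin (c • μ) := by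
  refine ⟨fun d X X' Y => ?_, fun d X Y Y' => ?_, fun X Y => ?_⟩
  · simp only [Pi.smul_apply, h.1]
    module
  · simp only [Pi.smul_apply, h.2.1]
    module
  · simp only [Pi.smul_apply]
    rw [h.2.2, smul_neg]

lemma sub {ν : Vm m} (h : IsSkewBilin μ) (h' : IsSkewBilin ν) : IsSkewBilin (μ - ν) := by
  refine ⟨fun d X X' Y => ?_, fun d X Y Y' => ?_, fun X Y => ?_⟩
  · simp only [Pi.sub_apply, h.1, h'.1]
    module
  · simp only [Pi.sub_apply, h.2.1, h'.2.1]
    module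
  · simp only [Pi.sub_apply]
    rw [h.2.2, h'.2.2]
    abel

lemma act_apply_stdb (h : IsSkewBilin μ) (g : GL (Fin m) ℝ) (i j k : Fin m) :
    _root_.act g μ (stdb m i) (stdb m j) k =
      ∑ l, ∑ a, ∑ b, g.1 k l * (g⁻¹).1 a i * (g⁻¹).1 b j * μ (stdb m a) (stdb m b) l := by
  simp only [_root_.act]
  rw [h.expand]
  simp only [Matrix.mulVec, dotProduct, Finset.sum_apply, Pi.smul_apply, smul_eq_mul,
    Finset.mul_sum, stdb, Pi.single_apply, mul_ite, mul_one, mul_zero, Finset.sum_ite_eq',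
    Finset.mem_univ, if_true]
  exact Finset.sum_congr rfl fun l _ => Finset.sum_congr rfl fun a _ =>
    Finset.sum_congr rfl fun b _ => by ring

lemma infAct_apply_stdb (h : IsSkewBilin μ) (A : Matrix (Fin m) (Fin m) ℝ) (i j k : Fin m) :
    _root_.infAct A μ (stdb m i) (stdb m j) k =
      ∑ l, A k l * μ (stdb m i) (stdb m j) l - ∑ a, A a i * μ (stdb m a) (stdb m j) k
        - ∑ b, A b j * μ (stdb m i) (stdb m b) k := by
  simp only [_root_.infAct, Pi.sub_apply]
  congr 1
  · congr 1
    rw [h.expand]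
    simp [Matrix.mulVec, dotProduct, stdb, Pi.single_apply]
  · rw [h.expand, Finset.sum_comm]
    simp [Matrix.mulVec, dotProduct, stdb, Pi.single_apply]

lemma normSq_pos (h : IsSkewBilin μ) (hne : μ ≠ 0) : 0 < normSq μ := by
  refine lt_of_le_of_ne (normSq_nonneg μ) fun h0 => hne ?_
  refine h.ext_stdb (by simp [IsSkewBilin]) fun i j k => ?_
  have h1 := (Finset.sum_eq_zero_iff_of_nonneg (fun _ _ => by positivity)).1 h0.symm i
    (Finset.mem_univ _)
  have h2 := (Finset.sum_eq_zero_iff_of_nonneg (fun _ _ => by positivity)).1 h1 j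
    (Finset.mem_univ _)
  have h3 := (Finset.sum_eq_zero_iff_of_nonneg (fun _ _ => by positivity)).1 h2 k
    (Finset.mem_univ _)
  simpa using h3

/-- The moment map identity: `ricPolar` represents the infinitesimal action. -/
lemma trace_ricPolar_mul (h : IsSkewBilin μ) {ν : Vm m} (h' : IsSkewBilin ν)
    {A : Matrix (Fin m) (Fin m) ℝ} (hA : Aᵀ = A) :
    (ricPolar μ ν * A).trace = 1 / 4 * brkInner (_root_.infAct A μ) ν := by
  have hA' : ∀ i j, A i j = A j i := fun i j => congrFun (congrFun hA j) i
  have e1 : ∑ i, ∑ j, ∑ k, (∑ l, A k l * μ (stdb m i) (stdb m j) l) * ν (stdb m i) (stdb m j) k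
      = ∑ x, ∑ y, (∑ i, ∑ j, μ (stdb m i) (stdb m j) x * ν (stdb m i) (stdb m j) y) * A y x := by
    simp only [Finset.sum_mul]
    rw [sum_comm₄ fun i j k l => A k l * μ (stdb m i) (stdb m j) l * ν (stdb m i) (stdb m j) k]
    exact Finset.sum_congr rfl fun l _ => Finset.sum_congr rfl fun k _ =>
      Finset.sum_congr rfl fun i _ => Finset.sum_congr rfl fun j _ => by ring
  have e2 : ∑ i, ∑ j, ∑ k, (∑ a, A a i * μ (stdb m a) (stdb m j) k) * ν (stdb m i) (stdb m j) k
      = ∑ x, ∑ y, (∑ i, ∑ j, μ (stdb m x) (stdb m i) j * ν (stdb m y) (stdb m i) j) * A y x := by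
    simp only [Finset.sum_mul]
    rw [sum_comm₄ fun i j k a => A a i * μ (stdb m a) (stdb m j) k * ν (stdb m i) (stdb m j) k]
    refine Finset.sum_congr rfl fun a _ => ?_
    rw [sum_rotate₃ fun k i j => A a i * μ (stdb m a) (stdb m j) k * ν (stdb m i) (stdb m j) k]
    exact Finset.sum_congr rfl fun l _ => Finset.sum_congr rfl fun k _ =>
      Finset.sum_congr rfl fun i _ => by rw [hA' a l]; ring
  have e3 : ∑ i, ∑ j, ∑ k, (∑ b, A b j * μ (stdb m i) (stdb m b) k) * ν (stdb m i) (stdb m j) k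
      = ∑ i, ∑ j, ∑ k, (∑ a, A a i * μ (stdb m a) (stdb m j) k) * ν (stdb m i) (stdb m j) k := by
    rw [Finset.sum_comm]
    refine Finset.sum_congr rfl fun i _ => Finset.sum_congr rfl fun j _ =>
      Finset.sum_congr rfl fun k _ => ?_
    rw [h'.2.2 (stdb m j) (stdb m i)]
    simp only [h.2.2 (stdb m j) _, Pi.neg_apply, mul_neg, Finset.sum_neg_distrib, neg_mul, neg_neg]
  have l : brkInner (_root_.infAct A μ) ν =
      ∑ i, ∑ j, ∑ k, (∑ l, A k l * μ (stdb m i) (stdb m j) l) * ν (stdb m i) (stdb m j) k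
      - ∑ i, ∑ j, ∑ k, (∑ a, A a i * μ (stdb m a) (stdb m j) k) * ν (stdb m i) (stdb m j) k
      - ∑ i, ∑ j, ∑ k, (∑ b, A b j * μ (stdb m i) (stdb m b) k) * ν (stdb m i) (stdb m j) k := by
    simp only [brkInner, h.infAct_apply_stdb, sub_mul, Finset.sum_sub_distrib]
  rw [l, e3, e1, e2]
  simp only [Matrix.trace, Matrix.diag, Matrix.mul_apply, ricPolar, Matrix.of_apply, add_mul,
    Finset.sum_add_distrib, mul_assoc, ← Finset.mul_sum]
  ring

end IsSkewBilin

lemma exists_orthogonal_diagonalization {m : ℕ} {A : Matrix (Fin m) (Fin m) ℝ} (hA : Aᵀ = A) :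
    ∃ (U : Matrix (Fin m) (Fin m) ℝ) (d : Fin m → ℝ),
      Antitone d ∧ Uᵀ * U = 1 ∧ A = U * Matrix.diagonal d * Uᵀ := by
  have hH : A.IsHermitian := by
    rw [Matrix.IsHermitian, Matrix.conjTranspose_eq_transpose_of_trivial, hA]
  let V : Matrix (Fin m) (Fin m) ℝ := hH.eigenvectorUnitary
  let σ := Tuple.sort fun i => -hH.eigenvalues i
  have hV : Vᵀ * V = 1 := by
    simpa [Matrix.star_eq_conjTranspose] using Unitary.coe_star_mul_self hH.eigenvectorUnitary
  have hAV : A = V * Matrix.diagonal hH.eigenvalues * Vᵀ := by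
    have := hH.spectral_theorem
    rw [Unitary.conjStarAlgAut_apply] at this
    exact this
  refine ⟨V.submatrix id σ, hH.eigenvalues ∘ σ, fun i j hij => ?_, ?_, ?_⟩
  · have := Tuple.monotone_sort (fun i => -hH.eigenvalues i) hij
    simpa using this
  · rw [Matrix.transpose_submatrix, ← Matrix.submatrix_mul _ _ _ _ _ Function.bijective_id, hV]
    simp
  · rw [← Matrix.submatrix_diagonal_equiv, Matrix.transpose_submatrix,
      Matrix.submatrix_mul_equiv, Matrix.submatrix_mul_equiv]
    simpa using hAV

lemma exists_orthogonal_triangular {m : ℕ} (M : Matrix (Fin m) (Fin m) ℝ) :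
    ∃ K : Matrix (Fin m) (Fin m) ℝ, Kᵀ * K = 1 ∧ (Kᵀ * M).BlockTriangular id := by
  let b := InnerProductSpace.gramSchmidtOrthonormalBasis (𝕜 := ℝ)
    (E := EuclideanSpace ℝ (Fin m)) (ι := Fin m) (by simp) fun j => WithLp.toLp 2 fun i => M i j
  refine ⟨Matrix.of fun x i => b i x, ?_, fun i j hij => ?_⟩
  · ext i j
    have := orthonormal_iff_ite.1 b.orthonormal i j
    rw [PiLp.inner_apply] at this
    simpa [Matrix.mul_apply, Matrix.one_apply, mul_comm] using this
  · have := InnerProductSpace.gramSchmidtOrthonormalBasis_inv_triangular (𝕜 := ℝ)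
      (E := EuclideanSpace ℝ (Fin m)) (ι := Fin m) (by simp)
      (fun j => WithLp.toLp 2 fun i => M i j) hij
    rw [PiLp.inner_apply] at this
    simpa [Matrix.mul_apply, mul_comm] using this

lemma Jst_transpose (n : ℕ) : (Jst n)ᵀ = -Jst n := by
  ext x y
  simp only [Jst, Matrix.transpose_apply, Matrix.neg_apply, Matrix.of_apply]
  have := x.2
  have := y.2
  split_ifs <;> first | omega | norm_num

lemma Jst_mul_self (n : ℕ) : Jst n * Jst n = -1 := by
  ext x z
  have hx := x.2
  rw [Matrix.mul_apply, Finset.sum_eq_single ⟨2 * n - 1 - x, by omega⟩]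
  · simp only [Jst, Matrix.neg_apply, Matrix.of_apply, Matrix.one_apply, Fin.ext_iff]
    have := z.2
    split_ifs <;> first | omega | norm_num
  · intro y _ hy
    have : (x : ℕ) + y ≠ 2 * n - 1 := fun h => hy (Fin.ext (by simp; omega))
    simp [Jst, this]
  · simp

section Action

variable {m : ℕ}

lemma act_mul (g h : GL (Fin m) ℝ) (μ : Vm m) : act (g * h) μ = act g (act h μ) := by
  funext X Y
  simp only [act, mul_inv_rev, Units.val_mul, ← Matrix.mulVec_mulVec]

lemma act_one (μ : Vm m) : act (1 : GL (Fin m) ℝ) μ = μ := by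
  funext X Y
  simp [act]

lemma act_smul (g : GL (Fin m) ℝ) (c : ℝ) (μ : Vm m) : act g (c • μ) = c • act g μ := by
  funext X Y
  simp [act, Matrix.mulVec_smul]

lemma infAct_act (g : GL (Fin m) ℝ) (A : Matrix (Fin m) (Fin m) ℝ) (μ : Vm m) :
    infAct (g.1 * A * (g⁻¹).1) (act g μ) = act g (infAct A μ) := by
  funext X Y
  have e : ∀ v, (g⁻¹).1.mulVec (g.1.mulVec v) = v := fun v => by
    rw [Matrix.mulVec_mulVec, ← Units.val_mul, inv_mul_cancel, Units.val_one, Matrix.one_mulVec]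
  simp only [infAct, act, ← Matrix.mulVec_mulVec, Matrix.mulVec_sub, e]

lemma IsSkewBilin.infAct_diagonal_apply_stdb {μ : Vm m} (h : IsSkewBilin μ) (d : Fin m → ℝ)
    (i j k : Fin m) : _root_.infAct (Matrix.diagonal d) μ (stdb m i) (stdb m j) k =
      (d k - d i - d j) * μ (stdb m i) (stdb m j) k := by
  rw [h.infAct_apply_stdb]
  simp [Matrix.diagonal_apply]
  ring

/-- An orthogonal matrix as an element of the general linear group. -/
def orthGL (U : Matrix (Fin m) (Fin m) ℝ) (hU : Uᵀ * U = 1) : GL (Fin m) ℝ :=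
  ⟨U, Uᵀ, mul_eq_one_comm.1 hU, hU⟩

lemma sum_dotProduct_orthogonal (P : Matrix (Fin m) (Fin m) ℝ) (hP : P * Pᵀ = 1)
    (L M : (Fin m → ℝ) →ₗ[ℝ] (Fin m → ℝ)) :
    ∑ i, L (P.mulVec (stdb m i)) ⬝ᵥ M (P.mulVec (stdb m i)) =
      ∑ i, L (stdb m i) ⬝ᵥ M (stdb m i) := by
  have key : ∀ A B : Matrix (Fin m) (Fin m) ℝ,
      ∑ i, (A.mulVec (stdb m i)) ⬝ᵥ (B.mulVec (stdb m i)) = (Aᵀ * B).trace := fun A B => by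
    simp [stdb, Matrix.trace, Matrix.mul_apply, dotProduct]
  obtain ⟨A, rfl⟩ := Matrix.toLin'.surjective L
  obtain ⟨B, rfl⟩ := Matrix.toLin'.surjective M
  simp only [Matrix.toLin'_apply, Matrix.mulVec_mulVec, key]
  rw [Matrix.transpose_mul, Matrix.mul_assoc, Matrix.trace_mul_comm, Matrix.mul_assoc,
    Matrix.mul_assoc, hP, Matrix.mul_one]

lemma brkInner_act_orthogonal {μ ν : Vm m} (h : IsSkewBilin μ) (h' : IsSkewBilin ν)
    (g : GL (Fin m) ℝ) (hg : g.1ᵀ * g.1 = 1) :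
    brkInner (act g μ) (act g ν) = brkInner μ ν := by
  have hinv : (g⁻¹).1 * (g⁻¹).1ᵀ = 1 := by
    have e : (g⁻¹).1 = g.1ᵀ := by
      rw [← Matrix.one_mul (g⁻¹).1, ← hg, Matrix.mul_assoc, ← Units.val_mul, mul_inv_cancel,
        Units.val_one, Matrix.mul_one]
    rw [e, Matrix.transpose_transpose, hg]
  have hdot : ∀ v w, (g.1.mulVec v) ⬝ᵥ (g.1.mulVec w) = v ⬝ᵥ w := fun v w => by
    rw [Matrix.dotProduct_mulVec, Matrix.vecMul_mulVec, ← Matrix.mulVec_transpose,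
      Matrix.transpose_mul, Matrix.transpose_transpose, hg, Matrix.one_mulVec]
  change ∑ i, ∑ j, (act g μ (stdb m i) (stdb m j)) ⬝ᵥ (act g ν (stdb m i) (stdb m j)) =
    ∑ i, ∑ j, (μ (stdb m i) (stdb m j)) ⬝ᵥ (ν (stdb m i) (stdb m j))
  simp only [act, hdot]
  have s1 : ∀ X, ∑ j, μ X ((g⁻¹).1.mulVec (stdb m j)) ⬝ᵥ ν X ((g⁻¹).1.mulVec (stdb m j)) =
      ∑ j, μ X (stdb m j) ⬝ᵥ ν X (stdb m j) := fun X =>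
    sum_dotProduct_orthogonal _ hinv (h.toLin X) (h'.toLin X)
  simp only [s1]
  refine Finset.sum_comm.trans (Eq.trans ?_ Finset.sum_comm)
  exact Finset.sum_congr rfl fun j _ =>
    sum_dotProduct_orthogonal _ hinv (h.toLin.flip (stdb m j)) (h'.toLin.flip (stdb m j))

end Action

lemma trace_mul_sq_le {m : ℕ} {A B : Matrix (Fin m) (Fin m) ℝ} (hA : Aᵀ = A) (hB : Bᵀ = B) :
    (A * B).trace ^ 2 ≤ (A * A).trace * (B * B).trace := by
  have key : ∀ C D : Matrix (Fin m) (Fin m) ℝ, Dᵀ = D →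
      (C * D).trace = ∑ p : Fin m × Fin m, C p.1 p.2 * D p.1 p.2 := fun C D hD => by
    rw [Fintype.sum_prod_type]
    refine Finset.sum_congr rfl fun i _ => ?_
    rw [Matrix.diag_apply, Matrix.mul_apply]
    refine Finset.sum_congr rfl fun j _ => ?_
    rw [← Matrix.transpose_apply D, hD]
  rw [key _ _ hA, key _ _ hB, key _ _ hB]
  simpa only [pow_two] using Finset.sum_mul_sq_le_sq_mul_sq Finset.univ
    (fun p : Fin m × Fin m => A p.1 p.2) fun p => B p.1 p.2

lemma hasDerivAt_matrix_mul_apply {m : ℕ} {M N : ℝ → Matrix (Fin m) (Fin m) ℝ}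
    {M' N' : Matrix (Fin m) (Fin m) ℝ} {t : ℝ}
    (hM : ∀ x y, HasDerivAt (fun s => M s x y) (M' x y) t)
    (hN : ∀ x y, HasDerivAt (fun s => N s x y) (N' x y) t) (x y : Fin m) :
    HasDerivAt (fun s => (M s * N s) x y) ((M' * N t + M t * N') x y) t := by
  simp only [Matrix.add_apply, Matrix.mul_apply, ← Finset.sum_add_distrib]
  exact HasDerivAt.fun_sum fun z _ => (hM x z).mul (hN z y)

section Symplectic

variable {n : ℕ}

lemma InSp_iff (g : GL (Fin (2 * n)) ℝ) : InSp n g ↔ g.1ᵀ * Jst n * g.1 = Jst n := by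
  have e : ∀ X Y, omegaSt n (g.1.mulVec X) (g.1.mulVec Y) =
      X ⬝ᵥ ((g.1ᵀ * Jst n * g.1).mulVec Y) := fun X Y => by
    change g.1.mulVec X ⬝ᵥ (Jst n).mulVec (g.1.mulVec Y) = _
    rw [← Matrix.mulVec_mulVec, ← Matrix.mulVec_mulVec, Matrix.dotProduct_mulVec X,
      Matrix.vecMul_transpose]
  refine ⟨fun h => ?_, fun h X Y => ?_⟩
  · ext i j
    have := h (Pi.single i 1) (Pi.single j 1)
    rw [e] at this
    change _ = _ ⬝ᵥ (Jst n).mulVec _ at this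
    simpa using this
  · rw [e, h]
    rfl

lemma Ricac_transpose (μ : Vm (2 * n)) : (Ricac n μ)ᵀ = Ricac n μ := by
  simp [Ricac, Matrix.transpose_mul, Jst_transpose, Ric_transpose, Matrix.mul_assoc]

lemma Jst_mul_Jst_mul (A : Matrix (Fin (2 * n)) (Fin (2 * n)) ℝ) :
    Jst n * (Jst n * A) = -A := by
  rw [← Matrix.mul_assoc, Jst_mul_self, neg_mul, one_mul]

lemma Jst_Ricac_Jst (μ : Vm (2 * n)) : Jst n * Ricac n μ * Jst n = Ricac n μ := by
  simp only [Ricac, Matrix.mul_smul, Matrix.smul_mul, Matrix.mul_add, Matrix.add_mul,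
    Matrix.mul_assoc, Jst_mul_self, Jst_mul_Jst_mul, neg_mul, mul_neg]
  simp [add_comm]

lemma trace_antiComplexify_mul (B : Matrix (Fin (2 * n)) (Fin (2 * n)) ℝ)
    {X : Matrix (Fin (2 * n)) (Fin (2 * n)) ℝ} (hX : Jst n * X * Jst n = X) :
    (((1 / 2 : ℝ) • (B + Jst n * B * Jst n)) * X).trace = (B * X).trace := by
  have : (Jst n * B * Jst n * X).trace = (B * X).trace := by
    rw [Matrix.mul_assoc, Matrix.mul_assoc, Matrix.trace_mul_comm, Matrix.mul_assoc, hX]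
  rw [Matrix.smul_mul, Matrix.add_mul, Matrix.trace_smul, Matrix.trace_add, this, smul_eq_mul]
  ring

lemma trace_Ricac_mul (μ : Vm (2 * n)) {X : Matrix (Fin (2 * n)) (Fin (2 * n)) ℝ}
    (hX : Jst n * X * Jst n = X) : (Ricac n μ * X).trace = (Ric μ * X).trace :=
  trace_antiComplexify_mul _ hX

/-- A conjugate `K d Kᵀ` of a diagonal matrix anticommutes with `J` iff the matrix of `J`
in the basis `K` only pairs opposite eigenvalues. -/
lemma Jst_conj_Jst_iff {K : Matrix (Fin (2 * n)) (Fin (2 * n)) ℝ} (hK : Kᵀ * K = 1)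
    (d : Fin (2 * n) → ℝ) :
    Jst n * (K * Matrix.diagonal d * Kᵀ) * Jst n = K * Matrix.diagonal d * Kᵀ ↔
      ∀ i j, (Kᵀ * Jst n * K) i j ≠ 0 → d i + d j = 0 := by
  have hK' : K * Kᵀ = 1 := mul_eq_one_comm.1 hK
  have hKl : ∀ A : Matrix (Fin (2 * n)) (Fin (2 * n)) ℝ, K * (Kᵀ * A) = A := fun A => by
    rw [← Matrix.mul_assoc, hK', Matrix.one_mul]
  have hKl' : ∀ A : Matrix (Fin (2 * n)) (Fin (2 * n)) ℝ, Kᵀ * (K * A) = A := fun A => by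
    rw [← Matrix.mul_assoc, hK, Matrix.one_mul]
  set W := Kᵀ * Jst n * K with hW
  have hJ : Jst n = K * W * Kᵀ := by
    simp only [hW, Matrix.mul_assoc, hK', hKl, Matrix.mul_one]
  have hWW : W * W = -1 := by
    simp only [hW, Matrix.mul_assoc, hKl, Jst_mul_Jst_mul]
    simp [hK]
  have e1 : (∀ i j, W i j ≠ 0 → d i + d j = 0) ↔
      W * Matrix.diagonal d = -(Matrix.diagonal d * W) := by
    rw [← Matrix.ext_iff]
    refine forall₂_congr fun i j => ?_
    rw [Matrix.mul_diagonal, Matrix.neg_apply, Matrix.diagonal_mul]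
    refine ⟨fun h => ?_, fun h hne => ?_⟩
    · by_cases h0 : W i j = 0
      · simp [h0]
      · linear_combination W i j * h h0
    · exact (mul_eq_zero.1 (by linear_combination h : W i j * (d i + d j) = 0)).resolve_left hne
  rw [e1]
  have e2 : Jst n * (K * Matrix.diagonal d * Kᵀ) * Jst n = K * (W * Matrix.diagonal d * W) * Kᵀ := by
    rw [hJ]
    simp only [Matrix.mul_assoc, hKl']
  rw [e2]
  constructor
  · intro h
    have h2 : W * Matrix.diagonal d * W = Matrix.diagonal d := by
      have := congrArg (fun A => Kᵀ * A * K) h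
      simpa only [Matrix.mul_assoc, hKl', hK, Matrix.mul_one] using this
    calc W * Matrix.diagonal d = -(W * Matrix.diagonal d * W * W) := by
          rw [Matrix.mul_assoc _ W W, hWW]; simp
      _ = _ := by rw [h2]
  · intro h
    rw [h]
    simp [Matrix.mul_assoc, hWW]

end Symplectic

lemma Matrix.BlockTriangular.unit_inv {m : ℕ} {T : GL (Fin m) ℝ} (hT : T.1.BlockTriangular id) :
    (T⁻¹).1.BlockTriangular id := by
  have : Invertible T.1 := T.isUnit.invertible
  rw [Matrix.coe_units_inv]
  exact Matrix.blockTriangular_inv_of_blockTriangular hT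

/-- Upper triangular matrices move a bracket which is homogeneous of weight `c` for a decreasing
grading into the part of weight at least `c`. -/
lemma act_triangular_apply_eq_zero {m : ℕ} {μ : Vm m} (h : IsSkewBilin μ) {d : Fin m → ℝ}
    (hd : Antitone d) {c : ℝ} (hμ : infAct (Matrix.diagonal d) μ = c • μ) {T : GL (Fin m) ℝ}
    (hT : T.1.BlockTriangular id) {i j k : Fin m} (hlt : d k - d i - d j < c) :
    act T μ (stdb m i) (stdb m j) k = 0 := by
  rw [h.act_apply_stdb]
  refine Finset.sum_eq_zero fun l _ => Finset.sum_eq_zero fun a _ =>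
    Finset.sum_eq_zero fun b _ => ?_
  by_contra hne
  simp only [mul_eq_zero, not_or] at hne
  obtain ⟨⟨⟨h1, h2⟩, h3⟩, h4⟩ := hne
  have hkl : k ≤ l := not_lt.1 fun hlt => h1 (hT hlt)
  have hai : a ≤ i := not_lt.1 fun hlt => h2 (hT.unit_inv hlt)
  have hbj : b ≤ j := not_lt.1 fun hlt => h3 (hT.unit_inv hlt)
  have e := congrFun (congrFun (congrFun hμ (stdb m a)) (stdb m b)) l
  rw [h.infAct_diagonal_apply_stdb] at e
  have e' := mul_right_cancel₀ h4 e
  linarith [hd hkl, hd hai, hd hbj]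

/-- Adapting an orthogonal frame `K` to the flag obtained by moving an eigenflag by a symplectic
map preserves anticommutation with `J`. -/
lemma Jst_conj_Jst_of_triangular {n : ℕ} {U K : Matrix (Fin (2 * n)) (Fin (2 * n)) ℝ}
    {d : Fin (2 * n) → ℝ} (hd : Antitone d) (hU : Uᵀ * U = 1) (hK : Kᵀ * K = 1)
    (hX : Jst n * (U * Matrix.diagonal d * Uᵀ) * Jst n = U * Matrix.diagonal d * Uᵀ)
    {g T : GL (Fin (2 * n)) ℝ} (hg : g.1ᵀ * Jst n * g.1 = Jst n)
    (hT : T.1.BlockTriangular id) (hKT : K * T.1 = g.1 * U) :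
    Jst n * (K * Matrix.diagonal d * Kᵀ) * Jst n = K * Matrix.diagonal d * Kᵀ := by
  rw [Jst_conj_Jst_iff hU] at hX
  rw [Jst_conj_Jst_iff hK]
  set W := Uᵀ * Jst n * U with hW
  have hTT : T.1 * (T⁻¹).1 = 1 := by rw [← Units.val_mul, mul_inv_cancel, Units.val_one]
  have hTT' : (T⁻¹).1 * T.1 = 1 := mul_eq_one_comm.1 hTT
  have hW' : W = T.1ᵀ * (Kᵀ * Jst n * K) * T.1 := by
    have : T.1ᵀ * (Kᵀ * Jst n * K) * T.1 = (K * T.1)ᵀ * Jst n * (K * T.1) := by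
      simp only [Matrix.transpose_mul, Matrix.mul_assoc]
    rw [this, hKT, Matrix.transpose_mul, hW]
    conv_lhs => rw [← hg]
    simp only [Matrix.mul_assoc]
  have e1 : Kᵀ * Jst n * K = (T⁻¹).1ᵀ * W * (T⁻¹).1 := by
    rw [hW']
    have : (T⁻¹).1ᵀ * (T.1ᵀ * (Kᵀ * Jst n * K) * T.1) * (T⁻¹).1 =
        (T.1 * (T⁻¹).1)ᵀ * (Kᵀ * Jst n * K) * (T.1 * (T⁻¹).1) := by
      simp only [Matrix.transpose_mul, Matrix.mul_assoc]
    rw [this, hTT, Matrix.transpose_one, Matrix.one_mul, Matrix.mul_one]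
  have sq : ∀ P : Matrix (Fin (2 * n)) (Fin (2 * n)) ℝ, Pᵀ * P = 1 →
      (Pᵀ * Jst n * P) * (Pᵀ * Jst n * P) = -1 := fun P hP => by
    have hP' : ∀ A, P * (Pᵀ * A) = A := fun A => by
      rw [← Matrix.mul_assoc, mul_eq_one_comm.1 hP, Matrix.one_mul]
    simp only [Matrix.mul_assoc, hP', Jst_mul_Jst_mul, mul_neg, hP]
  -- Inverting the previous formula expresses the same matrix through `T` instead of `T⁻¹`.
  have e2 : Kᵀ * Jst n * K = T.1 * W * T.1ᵀ := by
    have h1 : (T.1 * W * T.1ᵀ) * (Kᵀ * Jst n * K) = -1 := by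
      have t : T.1ᵀ * (T⁻¹).1ᵀ = 1 := by rw [← Matrix.transpose_mul, hTT', Matrix.transpose_one]
      calc (T.1 * W * T.1ᵀ) * (Kᵀ * Jst n * K)
          = T.1 * (W * (T.1ᵀ * (T⁻¹).1ᵀ) * W) * (T⁻¹).1 := by
            rw [e1]; simp only [Matrix.mul_assoc]
        _ = -1 := by rw [t, Matrix.mul_one, sq U hU]; simp
    have h2 := sq K hK
    calc Kᵀ * Jst n * K = -((-1) * (Kᵀ * Jst n * K)) := by simp
      _ = -(T.1 * W * T.1ᵀ * ((Kᵀ * Jst n * K) * (Kᵀ * Jst n * K))) := by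
        rw [← h1]; simp only [Matrix.mul_assoc]
      _ = _ := by rw [h2]; simp
  intro i j hne
  apply le_antisymm
  · rw [e1, Matrix.mul_apply] at hne
    obtain ⟨b, -, hb⟩ := Finset.exists_ne_zero_of_sum_ne_zero hne
    rw [mul_ne_zero_iff, Matrix.mul_apply] at hb
    obtain ⟨a, -, ha⟩ := Finset.exists_ne_zero_of_sum_ne_zero hb.1
    rw [mul_ne_zero_iff] at ha
    have hai : a ≤ i := not_lt.1 fun hlt => ha.1 (hT.unit_inv hlt)
    have hbj : b ≤ j := not_lt.1 fun hlt => hb.2 (hT.unit_inv hlt)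
    linarith [hd hai, hd hbj, hX a b ha.2]
  · rw [e2, Matrix.mul_apply] at hne
    obtain ⟨b, -, hb⟩ := Finset.exists_ne_zero_of_sum_ne_zero hne
    rw [mul_ne_zero_iff, Matrix.mul_apply] at hb
    obtain ⟨a, -, ha⟩ := Finset.exists_ne_zero_of_sum_ne_zero hb.1
    rw [mul_ne_zero_iff] at ha
    have hai : i ≤ a := not_lt.1 fun hlt => ha.1 (hT hlt)
    have hbj : j ≤ b := not_lt.1 fun hlt => hb.2 (hT hlt)
    linarith [hd hai, hd hbj, hX a b ha.2]

lemma trace_conj_diagonal_sq {m : ℕ} {K : Matrix (Fin m) (Fin m) ℝ} (hK : Kᵀ * K = 1)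
    (d : Fin m → ℝ) : (K * Matrix.diagonal d * Kᵀ * (K * Matrix.diagonal d * Kᵀ)).trace =
      (Matrix.diagonal d * Matrix.diagonal d).trace := by
  have : K * Matrix.diagonal d * Kᵀ * (K * Matrix.diagonal d * Kᵀ) =
      K * (Matrix.diagonal d * ((Kᵀ * K) * (Matrix.diagonal d * Kᵀ))) := by
    simp only [Matrix.mul_assoc]
  rw [this, hK, Matrix.one_mul, Matrix.trace_mul_comm, Matrix.mul_assoc, Matrix.mul_assoc, hK,
    Matrix.mul_one]

lemma trace_mul_self_nonneg {m : ℕ} {A : Matrix (Fin m) (Fin m) ℝ} (hA : Aᵀ = A) :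
    0 ≤ (A * A).trace := by
  nth_rewrite 1 [← hA]
  refine Finset.sum_nonneg fun i _ => ?_
  rw [Matrix.diag_apply, Matrix.mul_apply]
  exact Finset.sum_nonneg fun j _ => mul_self_nonneg (A j i)

lemma act_ne_zero {m : ℕ} {μ : Vm m} (hne : μ ≠ 0) (g : GL (Fin m) ℝ) :
    act g μ ≠ 0 := fun h0 => hne <| by
  rw [← act_one μ, ← inv_mul_cancel g, act_mul, h0]
  funext X Y
  simp [act]

lemma infAct_eq_neg_smul_iff_isDeriv {m : ℕ} {μ : Vm m} (h : IsSkewBilin μ)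
    (R : Matrix (Fin m) (Fin m) ℝ) (c : ℝ) :
    infAct R μ = (-c) • μ ↔ IsDeriv μ (R - c • 1) := by
  have sl : ∀ X Y, μ (c • X) Y = c • μ X Y := fun X Y => LinearMap.map_smul₂ h.toLin c X Y
  have sr : ∀ X Y, μ X (c • Y) = c • μ X Y := fun X Y => map_smul (h.toLin X) c Y
  have al : ∀ X X' Y, μ (X - X') Y = μ X Y - μ X' Y := fun X X' Y =>
    LinearMap.map_sub₂ h.toLin X X' Y
  have ar : ∀ X Y Y', μ X (Y - Y') = μ X Y - μ X Y' := fun X Y Y' => map_sub (h.toLin X) Y Y'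
  rw [funext_iff]
  refine forall_congr' fun X => ?_
  rw [funext_iff]
  refine forall_congr' fun Y => ?_
  simp only [infAct, Pi.smul_apply, Matrix.sub_mulVec, Matrix.smul_mulVec, Matrix.one_mulVec,
    sl, sr, al, ar, neg_smul]
  constructor <;> intro e
  · linear_combination e
  · linear_combination e

lemma trace_Ricac_sq_le_of_infAct_eq_smul {n : ℕ} {μ : Vm (2 * n)} (h : IsSkewBilin μ)
    (hne : μ ≠ 0) {c : ℝ} (hc : infAct (Ricac n μ) μ = c • μ) {g : GL (Fin (2 * n)) ℝ}
    (hg : InSp n g) :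
    Matrix.trace (Ricac n μ * Ricac n μ) / (normSq μ) ^ 2 ≤
      Matrix.trace (Ricac n (act g μ) * Ricac n (act g μ)) / (normSq (act g μ)) ^ 2 := by
  obtain ⟨U, d, hd, hU, hR⟩ := exists_orthogonal_diagonalization (Ricac_transpose μ)
  obtain ⟨K, hK, hT⟩ := exists_orthogonal_triangular (g.1 * U)
  set T : GL (Fin (2 * n)) ℝ := (orthGL K hK)⁻¹ * g * orthGL U hU with hTdef
  have hT' : T.1.BlockTriangular id := by
    have : T.1 = Kᵀ * (g.1 * U) := by rw [← Matrix.mul_assoc]; rfl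
    rwa [this]
  have hKT : K * T.1 = g.1 * U := by
    change K * (Kᵀ * g.1 * U) = _
    rw [← Matrix.mul_assoc, ← Matrix.mul_assoc, mul_eq_one_comm.1 hK, Matrix.one_mul]
  set X := K * Matrix.diagonal d * Kᵀ with hX
  have hXt : Xᵀ = X := by simp [hX, Matrix.transpose_mul, Matrix.mul_assoc]
  have hXJ : Jst n * X * Jst n = X :=
    Jst_conj_Jst_of_triangular hd hU hK (hR ▸ Jst_Ricac_Jst μ) ((InSp_iff g).1 hg) hT' hKT
  have hXX : (X * X).trace = (Ricac n μ * Ricac n μ).trace := by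
    rw [hX, trace_conj_diagonal_sq hK, hR, trace_conj_diagonal_sq hU]
  set A := act (orthGL U hU)⁻¹ μ with hA
  have hAs : IsSkewBilin A := h.act _
  have hAc : infAct (Matrix.diagonal d) A = c • A := by
    have e := infAct_act (orthGL U hU)⁻¹ (Ricac n μ) μ
    rw [hc, act_smul] at e
    rw [← e]
    congr 1
    change _ = Uᵀ * Ricac n μ * U
    rw [hR, Matrix.mul_assoc, Matrix.mul_assoc, Matrix.mul_assoc, hU, Matrix.mul_one,
      ← Matrix.mul_assoc, hU, Matrix.one_mul]
  set ν := act g μ with hν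
  have hνs : IsSkewBilin ν := h.act g
  set C := act (orthGL K hK)⁻¹ ν with hC
  have hCs : IsSkewBilin C := hνs.act _
  have hCT : C = act T A := by
    rw [hC, hν, hA, ← act_mul, ← act_mul, hTdef, mul_assoc, mul_inv_cancel, mul_one]
  have hνC : ν = act (orthGL K hK) C := by rw [hC, ← act_mul, mul_inv_cancel, act_one]
  have hnorm : normSq ν = normSq C := by
    rw [normSq_eq_brkInner, normSq_eq_brkInner, hνC, brkInner_act_orthogonal hCs hCs _ hK]
  have htr : c / 4 * normSq ν ≤ (Ricac n ν * X).trace := by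
    have e : (Ricac n ν * X).trace = 1 / 4 * brkInner (infAct (Matrix.diagonal d) C) C := by
      rw [trace_Ricac_mul _ hXJ, ← ricPolar_self, hνs.trace_ricPolar_mul hνs hXt,
        ← brkInner_act_orthogonal (hCs.infAct _) hCs (orthGL K hK) hK, ← infAct_act, ← hνC]
      rfl
    rw [e, hnorm]
    have : c * normSq C ≤ brkInner (infAct (Matrix.diagonal d) C) C := by
      simp only [normSq, brkInner, Finset.mul_sum]
      refine Finset.sum_le_sum fun i _ => Finset.sum_le_sum fun j _ =>
        Finset.sum_le_sum fun k _ => ?_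
      rw [hCs.infAct_diagonal_apply_stdb, mul_assoc, ← pow_two]
      rcases lt_or_ge (d k - d i - d j) c with hlt | hge
      · simp [hCT, act_triangular_apply_eq_zero hAs hd hAc hT' hlt]
      · exact mul_le_mul_of_nonneg_right hge (sq_nonneg _)
    linarith
  have hT0 : (Ricac n μ * Ricac n μ).trace = c / 4 * normSq μ := by
    rw [trace_Ricac_mul _ (Jst_Ricac_Jst μ), ← ricPolar_self,
      h.trace_ricPolar_mul h (Ricac_transpose μ), hc, normSq_eq_brkInner]
    simp only [brkInner, Pi.smul_apply, smul_eq_mul, mul_assoc, ← Finset.mul_sum]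
    ring
  have hN : 0 < normSq μ := h.normSq_pos hne
  have hN' : 0 < normSq ν := hνs.normSq_pos (act_ne_zero hne g)
  have hcs := trace_mul_sq_le (Ricac_transpose ν) hXt
  rw [hXX, hT0] at hcs
  have hc0 : 0 ≤ c := by
    have : 0 ≤ (Ricac n μ * Ricac n μ).trace := 
      trace_mul_self_nonneg (Ricac_transpose μ)
    rw [hT0] at this
    by_contra! hlt
    nlinarith
  have hsq : (c / 4 * normSq ν) ^ 2 ≤ (Ricac n ν * Ricac n ν).trace * (c / 4 * normSq μ) :=
    (pow_le_pow_left₀ (by positivity) htr 2).trans hcs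
  rw [hT0, div_le_div_iff₀ (by positivity) (by positivity)]
  rcases hc0.eq_or_lt with rfl | hcpos
  · have : 0 ≤ (Ricac n ν * Ricac n ν).trace := 
      trace_mul_self_nonneg (Ricac_transpose ν)
    simp only [zero_div, zero_mul]
    positivity
  · have : c / 4 * normSq ν ^ 2 ≤ (Ricac n ν * Ricac n ν).trace * normSq μ := by
      refine le_of_mul_le_mul_left ?_ (by positivity : 0 < c / 4)
      linarith
    nlinarith

/-- The diagonal one-parameter group `exp (t d)`. -/
noncomputable def expDiagGL {m : ℕ} (d : Fin m → ℝ) (t : ℝ) : GL (Fin m) ℝ :=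
  ⟨Matrix.diagonal fun i => Real.exp (t * d i), Matrix.diagonal fun i => Real.exp (-(t * d i)),
    by simp [Matrix.diagonal_mul_diagonal, ← Real.exp_add],
    by simp [Matrix.diagonal_mul_diagonal, ← Real.exp_add]⟩

lemma IsSkewBilin.act_expDiagGL_apply_stdb {m : ℕ} {μ : Vm m} (h : IsSkewBilin μ)
    (d : Fin m → ℝ) (t : ℝ) (i j k : Fin m) :
    _root_.act (expDiagGL d t) μ (stdb m i) (stdb m j) k =
      Real.exp (t * (d k - d i - d j)) * μ (stdb m i) (stdb m j) k := by
  have e : Real.exp (t * (d k - d i - d j)) =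
      Real.exp (t * d k) * Real.exp (-(t * d i)) * Real.exp (-(t * d j)) := by
    rw [← Real.exp_add, ← Real.exp_add]
    ring_nf
  rw [h.act_apply_stdb, e]
  change ∑ l, ∑ a, ∑ b, Matrix.diagonal (fun i => Real.exp (t * d i)) k l *
    Matrix.diagonal (fun i => Real.exp (-(t * d i))) a i *
    Matrix.diagonal (fun i => Real.exp (-(t * d i))) b j * _ = _
  simp [Matrix.diagonal_apply]

lemma IsSkewBilin.hasDerivAt_act_conj_expDiagGL {m : ℕ} {μ : Vm m} (h : IsSkewBilin μ)
    (d : Fin m → ℝ) (U : GL (Fin m) ℝ) (i j k : Fin m) :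
    HasDerivAt
      (fun t => _root_.act (U * expDiagGL d t * U⁻¹) μ (stdb m i) (stdb m j) k)
      (_root_.infAct (U.1 * Matrix.diagonal d * (U⁻¹).1) μ (stdb m i) (stdb m j) k) 0 := by
  set A := _root_.act U⁻¹ μ with hA
  have hAs : IsSkewBilin A := h.act _
  have hμ : μ = _root_.act U A := by rw [hA, ← act_mul, mul_inv_cancel, act_one]
  have e : ∀ t, _root_.act (U * expDiagGL d t * U⁻¹) μ =
      _root_.act U (_root_.act (expDiagGL d t) A) := fun t => by
    rw [hA, act_mul, act_mul]
  simp only [e]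
  conv in (_root_.infAct _ μ) => rw [hμ]
  rw [infAct_act, (hAs.infAct _).act_apply_stdb]
  simp only [fun t => (hAs.act (expDiagGL d t)).act_apply_stdb U]
  refine HasDerivAt.fun_sum fun l _ => HasDerivAt.fun_sum fun a _ =>
    HasDerivAt.fun_sum fun b _ => HasDerivAt.const_mul (𝔸 := ℝ) _ ?_
  simp only [hAs.act_expDiagGL_apply_stdb, hAs.infAct_diagonal_apply_stdb]
  refine HasDerivAt.mul_const (𝔸 := ℝ) ?_ _
  simpa using ((hasDerivAt_id (0 : ℝ)).mul_const (d l - d a - d b)).exp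

lemma inSp_conj_expDiagGL {n : ℕ} {U : Matrix (Fin (2 * n)) (Fin (2 * n)) ℝ} (hU : Uᵀ * U = 1)
    {d : Fin (2 * n) → ℝ}
    (hX : Jst n * (U * Matrix.diagonal d * Uᵀ) * Jst n = U * Matrix.diagonal d * Uᵀ) (t : ℝ) :
    InSp n (orthGL U hU * expDiagGL d t * (orthGL U hU)⁻¹) := by
  rw [Jst_conj_Jst_iff hU] at hX
  rw [InSp_iff]
  set E : Matrix (Fin (2 * n)) (Fin (2 * n)) ℝ := Matrix.diagonal fun i => Real.exp (t * d i)
    with hE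
  change (U * E * Uᵀ)ᵀ * Jst n * (U * E * Uᵀ) = Jst n
  have hU' : U * Uᵀ = 1 := mul_eq_one_comm.1 hU
  have key : E * (Uᵀ * Jst n * U) * E = Uᵀ * Jst n * U := by
    ext i j
    rw [hE, Matrix.mul_diagonal, Matrix.diagonal_mul]
    by_cases h0 : (Uᵀ * Jst n * U) i j = 0
    · simp [h0]
    · have : Real.exp (t * d i) * Real.exp (t * d j) = 1 := by
        rw [← Real.exp_add, ← mul_add, hX i j h0, mul_zero, Real.exp_zero]
      linear_combination (Uᵀ * Jst n * U) i j * this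
  calc (U * E * Uᵀ)ᵀ * Jst n * (U * E * Uᵀ)
      = U * (E * (Uᵀ * Jst n * U) * E) * Uᵀ := by
        simp only [Matrix.transpose_mul, Matrix.transpose_transpose, hE, Matrix.diagonal_transpose,
          Matrix.mul_assoc]
    _ = (U * Uᵀ) * Jst n * (U * Uᵀ) := by
        rw [key]
        simp only [Matrix.mul_assoc]
    _ = Jst n := by rw [hU', Matrix.one_mul, Matrix.mul_one]

section Derivatives

variable {m : ℕ} {μ : ℝ → Vm m} {ν : Vm m} {t : ℝ}

lemma hasDerivAt_Ric_apply
    (h : ∀ i j k, HasDerivAt (fun s => μ s (stdb m i) (stdb m j) k) (ν (stdb m i) (stdb m j) k) t)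
    (x y : Fin m) :
    HasDerivAt (fun s => Ric (μ s) x y) ((ricPolar ν (μ t) + ricPolar (μ t) ν) x y) t := by
  have e : (ricPolar ν (μ t) + ricPolar (μ t) ν) x y =
      -(1/2) * (∑ i, ∑ j, (ν (stdb m x) (stdb m i) j * μ t (stdb m y) (stdb m i) j +
        μ t (stdb m x) (stdb m i) j * ν (stdb m y) (stdb m i) j))
      + (1/4) * (∑ i, ∑ j, (ν (stdb m i) (stdb m j) x * μ t (stdb m i) (stdb m j) y +
        μ t (stdb m i) (stdb m j) x * ν (stdb m i) (stdb m j) y)) := by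
    simp only [ricPolar, Matrix.add_apply, Matrix.of_apply, Finset.sum_add_distrib]
    ring
  rw [e]
  simp only [Ric, Matrix.of_apply]
  exact ((HasDerivAt.fun_sum fun i _ => HasDerivAt.fun_sum fun j _ =>
    (h x i j).mul (h y i j)).const_mul _).add
    ((HasDerivAt.fun_sum fun i _ => HasDerivAt.fun_sum fun j _ =>
      (h i j x).mul (h i j y)).const_mul _)

lemma hasDerivAt_normSq
    (h : ∀ i j k, HasDerivAt (fun s => μ s (stdb m i) (stdb m j) k) (ν (stdb m i) (stdb m j) k) t) :
    HasDerivAt (fun s => normSq (μ s)) (2 * brkInner ν (μ t)) t := by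
  simp only [normSq, brkInner, Finset.mul_sum]
  refine HasDerivAt.fun_sum fun i _ => HasDerivAt.fun_sum fun j _ =>
    HasDerivAt.fun_sum fun k _ => ?_
  refine ((h i j k).fun_pow 2).congr_deriv ?_
  rw [pow_one]
  push_cast
  ring

end Derivatives

lemma hasDerivAt_trace_Ricac_sq {n : ℕ} {μ : ℝ → Vm (2 * n)} {ν : Vm (2 * n)} {t : ℝ}
    (h : ∀ i j k, HasDerivAt (fun s => μ s (stdb _ i) (stdb _ j) k) (ν (stdb _ i) (stdb _ j) k) t)
    (hμ : IsSkewBilin (μ t)) (hν : IsSkewBilin ν) :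
    HasDerivAt (fun s => (Ricac n (μ s) * Ricac n (μ s)).trace)
      (brkInner (infAct (Ricac n (μ t)) (μ t)) ν) t := by
  set B := ricPolar ν (μ t) + ricPolar (μ t) ν with hB
  set R := Ricac n (μ t) with hR
  set M := (1 / 2 : ℝ) • (B + Jst n * B * Jst n) with hM
  have hRic : ∀ x y, HasDerivAt (fun s => Ric (μ s) x y) (B x y) t := hasDerivAt_Ric_apply h
  have hJ : ∀ x y, HasDerivAt (fun _ : ℝ => Jst n x y) ((0 : Matrix _ _ ℝ) x y) t :=
    fun x y => hasDerivAt_const _ _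
  have hRicac : ∀ x y, HasDerivAt (fun s => Ricac n (μ s) x y) (M x y) t := fun x y => by
    have := ((hRic x y).fun_add (hasDerivAt_matrix_mul_apply
      (hasDerivAt_matrix_mul_apply hJ hRic) hJ x y)).const_mul (1 / 2 : ℝ)
    simpa only [zero_mul, zero_add, mul_zero, add_zero] using! this
  have hBt : (B * R).trace = 1 / 2 * brkInner (infAct R (μ t)) ν := by
    have e := hμ.trace_ricPolar_mul hν (Ricac_transpose (μ t))
    have e' : (ricPolar ν (μ t) * R).trace = (ricPolar (μ t) ν * R).trace := by
      have : ricPolar ν (μ t) = (ricPolar (μ t) ν)ᵀ := by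
        ext x y
        simp only [ricPolar, Matrix.transpose_apply, Matrix.of_apply, mul_comm]
      rw [this, ← Matrix.trace_transpose, Matrix.transpose_mul, Matrix.transpose_transpose,
        Ricac_transpose, Matrix.trace_mul_comm]
    rw [hB, Matrix.add_mul, Matrix.trace_add, e', e]
    ring
  have e : brkInner (infAct R (μ t)) ν = (M * R + R * M).trace := by
    rw [Matrix.trace_add, Matrix.trace_mul_comm R M, hM,
      trace_antiComplexify_mul _ (Jst_Ricac_Jst (μ t)), hBt]
    ring
  rw [e]
  exact HasDerivAt.fun_sum fun x _ => hasDerivAt_matrix_mul_apply hRicac hRicac x x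

lemma normSq_smul_sub_smul {m : ℕ} (μ ν : Vm m) (a b : ℝ) :
    normSq (a • ν - b • μ) = a ^ 2 * normSq ν - 2 * a * b * brkInner ν μ + b ^ 2 * normSq μ := by
  simp only [normSq, brkInner, Finset.mul_sum, ← Finset.sum_sub_distrib, ← Finset.sum_add_distrib,
    Pi.sub_apply, Pi.smul_apply, smul_eq_mul]
  exact Finset.sum_congr rfl fun i _ => Finset.sum_congr rfl fun j _ =>
    Finset.sum_congr rfl fun k _ => by ring

/-- The equality case of the Cauchy-Schwarz inequality for brackets. -/
lemma eq_smul_of_brkInner_sq_eq {m : ℕ} {μ ν : Vm m} (hμ : IsSkewBilin μ) (hν : IsSkewBilin ν)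
    (hN : 0 < normSq μ) (h : normSq ν * normSq μ = brkInner ν μ ^ 2) :
    ν = (brkInner ν μ / normSq μ) • μ := by
  have key : normSq (normSq μ • ν - brkInner ν μ • μ) = 0 := by
    rw [normSq_smul_sub_smul]
    linear_combination normSq μ * h
  have e : normSq μ • ν - brkInner ν μ • μ = 0 := by
    by_contra hne
    exact (((hν.smul _).sub (hμ.smul _)).normSq_pos hne).ne' key
  rw [div_eq_inv_mul, mul_smul, ← sub_eq_zero.1 e, inv_smul_smul₀ hN.ne']

lemma infAct_eq_smul_of_isMin {n : ℕ} {μ : Vm (2 * n)} (h : IsSkewBilin μ) (hne : μ ≠ 0)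
    (hmin : ∀ g : GL (Fin (2 * n)) ℝ, InSp n g →
      Matrix.trace (Ricac n μ * Ricac n μ) / (normSq μ) ^ 2 ≤
        Matrix.trace (Ricac n (act g μ) * Ricac n (act g μ)) / (normSq (act g μ)) ^ 2) :
    ∃ c : ℝ, infAct (Ricac n μ) μ = c • μ := by
  obtain ⟨U, d, -, hU, hR⟩ := exists_orthogonal_diagonalization (Ricac_transpose μ)
  have hN : 0 < normSq μ := h.normSq_pos hne
  set ν := infAct (Ricac n μ) μ with hν
  have hνs : IsSkewBilin ν := h.infAct _
  let γ : ℝ → Vm (2 * n) := fun t => act (orthGL U hU * expDiagGL d t * (orthGL U hU)⁻¹) μ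
  have hγ0 : γ 0 = μ := by
    have : expDiagGL d 0 = 1 := by
      ext i j
      simp [expDiagGL]
    simp only [γ, this, mul_one, mul_inv_cancel, act_one]
  have hγ : ∀ i j k, HasDerivAt (fun t => γ t (stdb _ i) (stdb _ j) k)
      (ν (stdb _ i) (stdb _ j) k) 0 := fun i j k => by
    rw [hν, hR]
    exact h.hasDerivAt_act_conj_expDiagGL d (orthGL U hU) i j k
  have hT := hasDerivAt_trace_Ricac_sq hγ (hγ0.symm ▸ h) hνs
  have hD := (hasDerivAt_normSq hγ).fun_pow 2
  have hF := hT.fun_div hD (by rw [hγ0]; positivity)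
  have hloc : IsLocalMin (fun t => (Ricac n (γ t) * Ricac n (γ t)).trace / normSq (γ t) ^ 2) 0 :=
    Filter.Eventually.of_forall fun t => by
      simp only [hγ0]
      exact hmin _ (inSp_conj_expDiagGL hU (hR ▸ Jst_Ricac_Jst μ) t)
  have h0 := hloc.hasDerivAt_eq_zero hF
  have hT0 : (Ricac n μ * Ricac n μ).trace = 1 / 4 * brkInner ν μ := by
    rw [trace_Ricac_mul _ (Jst_Ricac_Jst μ), ← ricPolar_self,
      h.trace_ricPolar_mul h (Ricac_transpose μ)]
  simp only [hγ0, ← hν, hT0, ← normSq_eq_brkInner] at h0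
  rw [div_eq_zero_iff, or_iff_left (by positivity)] at h0
  refine ⟨_, eq_smul_of_brkInner_sq_eq h hνs hN ?_⟩
  refine mul_left_cancel₀ hN.ne' ?_
  push_cast at h0
  linear_combination h0

/-- for a nonzero nilpotent Lie bracket `μ` on `ℝ^{2n}` with `ω` closed,
`μ` minimizes `tr(Ricac²)/‖·‖⁴` along its `Sp(n,ℝ)`-orbit iff `Ricac_μ = cI + D`
with `D` a derivation. -/
theorem symplectic_minimal_iff_Ricac_eq_scalar_add_deriv (n : ℕ) (μ : Vm (2*n))
    (hskew : IsSkewBilin μ) (hjac : Jacobi μ) (hnil : IsNilp μ) (hne : μ ≠ 0)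
    (hcl : OmegaClosed n μ) :
    (∀ g : GL (Fin (2*n)) ℝ, InSp n g →
        Matrix.trace (Ricac n μ * Ricac n μ) / (normSq μ) ^ 2 ≤
          Matrix.trace (Ricac n (act g μ) * Ricac n (act g μ)) / (normSq (act g μ)) ^ 2) ↔
      (∃ (c : ℝ) (D : Matrix (Fin (2*n)) (Fin (2*n)) ℝ),
        Ricac n μ = c • (1 : Matrix (Fin (2*n)) (Fin (2*n)) ℝ) + D ∧ IsDeriv μ D) := by
  constructor
  · intro hmin
    obtain ⟨c, hc⟩ := infAct_eq_smul_of_isMin hskew hne hmin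
    refine ⟨-c, Ricac n μ - (-c) • 1, by abel, ?_⟩
    rwa [← infAct_eq_neg_smul_iff_isDeriv hskew, neg_neg]
  · rintro ⟨c, D, hR, hD⟩ g hg
    refine trace_Ricac_sq_le_of_infAct_eq_smul hskew hne (c := -c) ?_ hg
    rwa [infAct_eq_neg_smul_iff_isDeriv hskew, hR, add_sub_cancel_left]
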